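/- Let A be a real n×n symmetric positive semidefinite matrix of rank r with eigenvalues λ₁ ≥ λ₂ ≥ … ≥ λ_n ≥ 0 (so λ_i > 0 exactly when i ≤ r). Let k and τ be integers with 1 ≤ k < τ < r. Define the n×n matrix N := Σ_{S ⊆ {1,…,n}, |S| = τ} A_{:,S} · adj(A_{S,S}) · A_{S,:} and the scalar D := Σ_{S ⊆ {1,…,n}, |S| = τ} det(A_{S,S}). Then D > 0, and for every w ∈ ℝⁿ: wᵀ N w ≥ D · (τ−k) / (τ−k−1 + Σ_{j=k+1}^{r} λ_j/λ_r) · wᵀAw. (This is the block-coordinate-descent analogue: the smallest positive eigenvalue of the expected projection A^{1/2}·E[I_Sᵀ(A_{S,S})^† I_S]·A^{1/2} under τ-DPP(A) sampling is at least (τ−k)/(τ−k−1+(r−k)·κ̄_k), where κ̄_k = (1/(r−k))·Σ_{j>k}^r λ_j/λ_r.) -/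

import Mathlib

open Matrix

/-- The row submatrix `A_{S,:}`. -/
def rowSub {n : ℕ} (A : Matrix (Fin n) (Fin n) ℝ) (S : Finset (Fin n)) :
    Matrix {x // x ∈ S} (Fin n) ℝ :=
  A.submatrix (fun i => (i : Fin n)) id

/-- The column submatrix `A_{:,S}`. -/
def colSub {n : ℕ} (A : Matrix (Fin n) (Fin n) ℝ) (S : Finset (Fin n)) :
    Matrix (Fin n) {x // x ∈ S} ℝ :=
  A.submatrix id (fun i => (i : Fin n))

/-- The adjugate `adj(M_{S,S})` of the principal submatrix of `M` indexed by `S`. -/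
noncomputable def principalAdj {n : ℕ} (M : Matrix (Fin n) (Fin n) ℝ)
    (S : Finset (Fin n)) : Matrix {x // x ∈ S} {x // x ∈ S} ℝ :=
  (M.submatrix (fun i : {x // x ∈ S} => (i : Fin n)) (fun i : {x // x ∈ S} => (i : Fin n))).adjugate

/-- The principal minor `det(M_{S,S})`. -/
noncomputable def principalMinor {n : ℕ} (M : Matrix (Fin n) (Fin n) ℝ)
    (S : Finset (Fin n)) : ℝ :=
  (M.submatrix (fun i : {x // x ∈ S} => (i : Fin n)) (fun i : {x // x ∈ S} => (i : Fin n))).det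

/-- **Matrix determinant lemma**, in adjugate form, for a real matrix that may be singular. -/
theorem det_add_vecMulVec_eq {m : Type*} [Fintype m] [DecidableEq m]
    (A : Matrix m m ℝ) (u v : m → ℝ) :
    (A + vecMulVec u v).det = A.det + v ⬝ᵥ (A.adjugate *ᵥ u) := by
  have hunit : ∀ B : Matrix m m ℝ, B.det ≠ 0 →
      (B + vecMulVec u v).det = B.det + v ⬝ᵥ (B.adjugate *ᵥ u) := by
    intro B hB
    have h := det_add_replicateCol_mul_replicateRow (ι := Unit) (isUnit_iff_ne_zero.2 hB) u v
    rw [← vecMulVec_eq] at h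
    rw [h, det_unique (n := Unit), Matrix.add_apply, Matrix.one_apply_eq, Matrix.mul_assoc,
      ← replicateCol_mulVec, replicateRow_mul_replicateCol_apply, Matrix.inv_def, smul_mulVec,
      dotProduct_smul, Ring.inverse_eq_inv', smul_eq_mul]
    field_simp
  have hdense : Dense {t : ℝ | (A + t • (1 : Matrix m m ℝ)).det ≠ 0} := by
    have hfin : {t : ℝ | (-A).charpoly.IsRoot t}.Finite :=
      Polynomial.finite_setOfPred_isRoot (-A).charpoly_monic.ne_zero
    refine hfin.countable.dense_compl ℝ |>.mono ?_
    intro t ht h0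
    apply ht
    simp only [Set.mem_ofPred_eq, Polynomial.IsRoot, eval_charpoly]
    rw [← h0]
    congr 1
    rw [sub_neg_eq_add, add_comm, scalar_apply, smul_one_eq_diagonal]
  have hext := Continuous.ext_on hdense
    (f := fun t : ℝ => (A + t • (1 : Matrix m m ℝ) + vecMulVec u v).det)
    (g := fun t : ℝ => (A + t • (1 : Matrix m m ℝ)).det
      + v ⬝ᵥ ((A + t • (1 : Matrix m m ℝ)).adjugate *ᵥ u))
    (by fun_prop) (by fun_prop) (fun t ht => hunit _ ht)
  simpa using congrFun hext 0

/-- The sum of the principal minors of a given order is invariant under orthogonal conjugation. -/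
theorem sum_principalMinor_conj {n : ℕ} (Q M : Matrix (Fin n) (Fin n) ℝ) (hQ : Qᵀ * Q = 1)
    (τ : ℕ) :
    ∑ S ∈ Finset.powersetCard τ (Finset.univ : Finset (Fin n)), principalMinor (Q * M * Qᵀ) S
      = ∑ S ∈ Finset.powersetCard τ (Finset.univ : Finset (Fin n)), principalMinor M S := by
  have hQC : Qᵀ.map Polynomial.C * Q.map Polynomial.C = 1 := by
    rw [← Matrix.map_mul, hQ, Matrix.map_one _ (map_zero _) (map_one _)]
  unfold principalMinor
  rw [← coeff_det_one_add_X_smul_eq_sum_minors, ← coeff_det_one_add_X_smul_eq_sum_minors,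
    Matrix.map_mul, Matrix.map_mul, Matrix.mul_assoc, ← Matrix.mul_smul, det_one_add_mul_comm,
    Matrix.smul_mul, Matrix.mul_assoc, hQC, Matrix.mul_one]

/-- The quadratic form of `A_{:,S} adj(A_{S,S}) A_{S,:}` is the change of the principal minor
under a rank-one update. -/
theorem dotProduct_principalAdj_mulVec {n : ℕ} (A : Matrix (Fin n) (Fin n) ℝ)
    (S : Finset (Fin n)) (w : Fin n → ℝ) :
    w ⬝ᵥ ((colSub A S * principalAdj A S * rowSub A S) *ᵥ w)
      = principalMinor (A + vecMulVec (A *ᵥ w) (w ᵥ* A)) S - principalMinor A S := by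
  have h := det_add_vecMulVec_eq
    (A.submatrix (fun i : {x // x ∈ S} => (i : Fin n)) (fun i : {x // x ∈ S} => (i : Fin n)))
    (fun i => (A *ᵥ w) i) (fun i => (w ᵥ* A) i)
  have hminor : principalMinor (A + vecMulVec (A *ᵥ w) (w ᵥ* A)) S = principalMinor A S
      + (fun i : {x // x ∈ S} => (w ᵥ* A) i) ⬝ᵥ
        (principalAdj A S *ᵥ (fun i : {x // x ∈ S} => (A *ᵥ w) i)) := h
  rw [hminor, add_sub_cancel_left, ← mulVec_mulVec, ← mulVec_mulVec, dotProduct_mulVec]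
  rfl

theorem principalMinor_diagonal {n : ℕ} (d : Fin n → ℝ) (S : Finset (Fin n)) :
    principalMinor (diagonal d) S = ∏ i ∈ S, d i := by
  unfold principalMinor
  rw [submatrix_diagonal _ _ Subtype.val_injective, det_diagonal]
  exact Finset.prod_coe_sort S d

theorem dotProduct_principalAdj_diagonal_mulVec {n : ℕ} (d : Fin n → ℝ)
    (S : Finset (Fin n)) (z : Fin n → ℝ) :
    z ⬝ᵥ ((colSub (diagonal d) S * principalAdj (diagonal d) S * rowSub (diagonal d) S) *ᵥ z)
      = ∑ i ∈ S, d i * z i ^ 2 * ∏ j ∈ S, d j := by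
  rw [← mulVec_mulVec, ← mulVec_mulVec, dotProduct_mulVec]
  have hrow : rowSub (diagonal d) S *ᵥ z = fun i : {x // x ∈ S} => d i * z i := by
    ext i
    exact mulVec_diagonal d z i
  have hcol : z ᵥ* colSub (diagonal d) S = fun i : {x // x ∈ S} => z i * d i := by
    ext i
    exact vecMul_diagonal z d i
  rw [hrow, hcol]
  unfold principalAdj
  rw [submatrix_diagonal _ _ Subtype.val_injective, adjugate_diagonal]
  simp only [dotProduct, mulVec_diagonal, Function.comp_apply]
  rw [← Finset.sum_coe_sort S]
  refine Finset.sum_congr rfl fun i _ => ?_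
  have hprod : d i * ∏ j ∈ Finset.univ.erase i, d (j : Fin n) = ∏ j ∈ S, d j := by
    rw [Finset.mul_prod_erase Finset.univ (fun j : {x // x ∈ S} => d j) (Finset.mem_univ i)]
    exact Finset.prod_coe_sort S d
  rw [← hprod]
  ring

/-- Exchanging `j` for `i` compares the square-free monomials avoiding `i` and containing `j`
with those containing `i`. -/
theorem mul_sum_prod_exchange_le {ι : Type*} [Fintype ι] [DecidableEq ι] (d : ι → ℝ)
    (hd : ∀ x, 0 ≤ d x) (τ : ℕ) {i j : ι} (hij : i ≠ j) :
    d i * ∑ S ∈ Finset.powersetCard τ Finset.univ with i ∉ S ∧ j ∈ S, ∏ x ∈ S, d x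
      ≤ d j * ∑ S ∈ Finset.powersetCard τ Finset.univ with i ∈ S, ∏ x ∈ S, d x := by
  have hswap : d i * ∑ S ∈ Finset.powersetCard τ Finset.univ with i ∉ S ∧ j ∈ S, ∏ x ∈ S, d x
      = d j * ∑ S ∈ Finset.powersetCard τ Finset.univ with i ∈ S ∧ j ∉ S, ∏ x ∈ S, d x := by
    rw [Finset.mul_sum, Finset.mul_sum]
    refine Finset.sum_nbij' (fun S => insert i (S.erase j)) (fun S => insert j (S.erase i))
      ?_ ?_ ?_ ?_ ?_
    · intro S hS
      simp only [Finset.mem_filter, Finset.mem_powersetCard_univ] at hS ⊢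
      obtain ⟨hc, hi, hj⟩ := hS
      refine ⟨?_, by simp, by simp [hij.symm]⟩
      rw [Finset.card_insert_of_notMem (by simp [hi]), Finset.card_erase_add_one hj, hc]
    · intro S hS
      simp only [Finset.mem_filter, Finset.mem_powersetCard_univ] at hS ⊢
      obtain ⟨hc, hi, hj⟩ := hS
      refine ⟨?_, by simp [hij], by simp⟩
      rw [Finset.card_insert_of_notMem (by simp [hj]), Finset.card_erase_add_one hi, hc]
    · intro S hS
      simp only [Finset.mem_filter] at hS
      rw [Finset.erase_insert (by simp [hS.2.1]), Finset.insert_erase hS.2.2]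
    · intro S hS
      simp only [Finset.mem_filter] at hS
      rw [Finset.erase_insert (by simp [hS.2.2]), Finset.insert_erase hS.2.1]
    · intro S hS
      simp only [Finset.mem_filter] at hS
      rw [Finset.prod_insert (by simp [hS.2.1]), ← Finset.mul_prod_erase S d hS.2.2]
      ring
  rw [hswap]
  refine mul_le_mul_of_nonneg_left ?_ (hd j)
  refine Finset.sum_le_sum_of_subset_of_nonneg ?_
    fun S _ _ => Finset.prod_nonneg fun x _ => hd x
  exact Finset.monotone_filter_right _ fun S _ h => h.1

/-- If at most `k` elements of the support of `d` other than `i` lie outside `G`, then every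
nonvanishing square-free monomial of degree `τ` avoiding `i` has at least `τ - k` variables
in `G`. -/
theorem sub_mul_sum_prod_le {ι : Type*} [Fintype ι] [DecidableEq ι] (d : ι → ℝ)
    (hd : ∀ x, 0 ≤ d x) (τ k : ℕ) (i : ι) (G R : Finset ι) (hR : ∀ x, d x ≠ 0 → x ∈ R)
    (hcard : (R.erase i \ G).card ≤ k) :
    ((τ : ℝ) - k) * ∑ S ∈ Finset.powersetCard τ Finset.univ with i ∉ S, ∏ x ∈ S, d x
      ≤ ∑ j ∈ G, ∑ S ∈ Finset.powersetCard τ Finset.univ with i ∉ S ∧ j ∈ S,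
          ∏ x ∈ S, d x := by
  have hcount : ∑ j ∈ G, ∑ S ∈ Finset.powersetCard τ Finset.univ with i ∉ S ∧ j ∈ S,
        ∏ x ∈ S, d x
      = ∑ S ∈ Finset.powersetCard τ Finset.univ with i ∉ S,
          ((G ∩ S).card : ℝ) * ∏ x ∈ S, d x := by
    simp_rw [← Finset.filter_filter, Finset.sum_filter (fun S => _ ∈ S)]
    rw [Finset.sum_comm]
    refine Finset.sum_congr rfl fun S _ => ?_
    rw [← Finset.sum_filter, Finset.sum_const, nsmul_eq_mul, Finset.filter_mem_eq_inter]
  rw [hcount, Finset.mul_sum]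
  refine Finset.sum_le_sum fun S hS => ?_
  simp only [Finset.mem_filter, Finset.mem_powersetCard_univ] at hS
  by_cases h0 : ∏ x ∈ S, d x = 0
  · simp [h0]
  refine mul_le_mul_of_nonneg_right ?_ (Finset.prod_nonneg fun x _ => hd x)
  have hsub : S \ G ⊆ R.erase i \ G := by
    refine Finset.sdiff_subset_sdiff (fun x hx => ?_) le_rfl
    refine Finset.mem_erase.2 ⟨fun h => hS.2 (h ▸ hx), hR x ?_⟩
    exact fun h => h0 (Finset.prod_eq_zero hx h)
  have h1 := (Finset.card_le_card hsub).trans hcard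
  have h2 := Finset.card_inter_add_card_sdiff S G
  rw [Finset.inter_comm] at h2
  have h3 : τ ≤ (G ∩ S).card + k := by omega
  have h4 : (τ : ℝ) ≤ (G ∩ S).card + k := by exact_mod_cast h3
  linarith

/-- Lower bound for the square-free monomials containing `i`, given a set `G` that misses `i`
and all but `k` of the other elements of the support. -/
theorem sub_mul_sum_prod_notMem_le {ι : Type*} [Fintype ι] [DecidableEq ι] (d : ι → ℝ)
    (hd : ∀ x, 0 ≤ d x) (τ k : ℕ) (i : ι) (G R : Finset ι)
    (hR : ∀ x, d x ≠ 0 → x ∈ R) (hiG : i ∉ G) (hcard : (R.erase i \ G).card ≤ k) :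
    d i * (((τ : ℝ) - k) *
        ∑ S ∈ Finset.powersetCard τ Finset.univ with i ∉ S, ∏ x ∈ S, d x)
      ≤ (∑ j ∈ G, d j) *
        ∑ S ∈ Finset.powersetCard τ Finset.univ with i ∈ S, ∏ x ∈ S, d x := by
  refine (mul_le_mul_of_nonneg_left (sub_mul_sum_prod_le d hd τ k i G R hR hcard)
    (hd i)).trans ?_
  rw [Finset.mul_sum, Finset.sum_mul]
  exact Finset.sum_le_sum fun j hj =>
    mul_sum_prod_exchange_le d hd τ fun h => hiG (h ▸ hj)

/-- With `d i = λ_{i+1}` decreasing, nonnegative and supported on the first `r` indices, each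
`i < r` satisfies the scalar inequality behind the spectral lower bound. -/
theorem sum_prod_mem_lower_bound {n r : ℕ} (lam : ℕ → ℝ) (hrn : r ≤ n)
    (hmono : ∀ i j : ℕ, 1 ≤ i → i ≤ j → j ≤ n → lam j ≤ lam i)
    (hnonneg : ∀ i : ℕ, 1 ≤ i → i ≤ n → 0 ≤ lam i)
    (hpos : ∀ i : ℕ, 1 ≤ i → i ≤ n → (0 < lam i ↔ i ≤ r))
    (k τ : ℕ) (hkτ : k < τ) (hτr : τ < r) (i : Fin n) (hir : (i : ℕ) < r) :
    (∑ S ∈ Finset.powersetCard τ (Finset.univ : Finset (Fin n)),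
        ∏ x ∈ S, lam ((x : ℕ) + 1)) * (((τ : ℝ) - k) /
          (((τ : ℝ) - k) - 1 + ∑ j ∈ Finset.Icc (k + 1) r, lam j / lam r))
      ≤ ∑ S ∈ Finset.powersetCard τ (Finset.univ : Finset (Fin n)) with i ∈ S,
          ∏ x ∈ S, lam ((x : ℕ) + 1) := by
  set d : Fin n → ℝ := fun x => lam ((x : ℕ) + 1) with hdef
  have hd : ∀ x, 0 ≤ d x := fun x => hnonneg _ (by omega) (by omega)
  have hlr : 0 < lam r := (hpos r (by omega) hrn).2 le_rfl
  have hle : ∀ x : Fin n, (x : ℕ) < r → lam r ≤ d x :=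
    fun x hx => hmono _ _ (by omega) (by omega) hrn
  set last : Fin n := ⟨r - 1, by omega⟩ with hlast
  set tail : Finset (Fin n) := {x | k ≤ (x : ℕ) ∧ (x : ℕ) < r} with htail
  set supp : Finset (Fin n) := {x | (x : ℕ) < r} with hsupp
  have hsum : ∑ j ∈ Finset.Icc (k + 1) r, lam j = ∑ x ∈ tail, d x := by
    symm
    refine Finset.sum_bij (fun x _ => (x : ℕ) + 1) ?_ ?_ ?_ ?_
    · intro x hx
      simp only [htail, Finset.mem_filter, Finset.mem_univ, true_and] at hx
      simp only [Finset.mem_Icc]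
      omega
    · intro x _ y _ h
      exact Fin.ext (by simpa using h)
    · intro j hj
      simp only [Finset.mem_Icc] at hj
      refine ⟨⟨j - 1, by omega⟩, ?_, ?_⟩
      · simp only [htail, Finset.mem_filter, Finset.mem_univ, true_and]
        omega
      · simp only
        omega
    · intro x _
      rfl
  have hR : ∀ x, d x ≠ 0 → x ∈ supp := by
    intro x hx
    have := (hpos ((x : ℕ) + 1) (by omega) (by omega)).1 (lt_of_le_of_ne (hd x) hx.symm)
    simp only [hsupp, Finset.mem_filter, Finset.mem_univ, true_and]
    omega
  have hfirst : (Finset.univ.filter fun x : Fin n => (x : ℕ) < k).card = k := by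
    rw [Fin.card_filter_val_lt]
    omega
  obtain ⟨m, hm, hiG, hcard⟩ : ∃ m ∈ tail, i ∉ tail.erase m ∧
      (supp.erase i \ tail.erase m).card ≤ k := by
    by_cases hi : k ≤ (i : ℕ)
    · refine ⟨i, by simp [htail, hi, hir], by simp, ?_⟩
      refine (Finset.card_le_card ?_).trans hfirst.le
      intro x hx
      simp only [hsupp, htail, Finset.mem_sdiff, Finset.mem_erase, Finset.mem_filter,
        Finset.mem_univ, true_and] at hx ⊢
      grind
    · refine ⟨last, ?_, by simp [htail, hi], ?_⟩
      · simp only [htail, hlast, Finset.mem_filter, Finset.mem_univ, true_and]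
        omega
      have hi' : i ∈ Finset.univ.filter fun x : Fin n => (x : ℕ) < k := by
        simpa using hi
      calc (supp.erase i \ tail.erase last).card
          ≤ (insert last ((Finset.univ.filter fun x : Fin n => (x : ℕ) < k).erase i)).card := by
            refine Finset.card_le_card ?_
            intro x hx
            simp only [hsupp, htail, Finset.mem_sdiff, Finset.mem_erase, Finset.mem_insert,
              Finset.mem_filter, Finset.mem_univ, true_and] at hx ⊢
            grind
        _ ≤ ((Finset.univ.filter fun x : Fin n => (x : ℕ) < k).erase i).card + 1 :=
            Finset.card_insert_le _ _
        _ = k := by rw [Finset.card_erase_add_one hi', hfirst]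
  have key := sub_mul_sum_prod_notMem_le d hd τ k i (tail.erase m) supp hR hiG hcard
  have hsplit := Finset.sum_filter_add_sum_filter_not
    (Finset.powersetCard τ (Finset.univ : Finset (Fin n))) (fun S => i ∈ S)
    (fun S => ∏ x ∈ S, d x)
  rw [← hsplit]
  have hP : 0 ≤ ∑ S ∈ Finset.powersetCard τ (Finset.univ : Finset (Fin n)) with i ∈ S,
      ∏ x ∈ S, d x := Finset.sum_nonneg fun S _ => Finset.prod_nonneg fun x _ => hd x
  have hN : 0 ≤ ∑ S ∈ Finset.powersetCard τ (Finset.univ : Finset (Fin n)) with i ∉ S,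
      ∏ x ∈ S, d x := Finset.sum_nonneg fun S _ => Finset.prod_nonneg fun x _ => hd x
  generalize (∑ S ∈ Finset.powersetCard τ (Finset.univ : Finset (Fin n)) with i ∈ S,
      ∏ x ∈ S, d x) = P at *
  generalize (∑ S ∈ Finset.powersetCard τ (Finset.univ : Finset (Fin n)) with i ∉ S,
      ∏ x ∈ S, d x) = N at *
  have herase : ∑ x ∈ tail.erase m, d x = ∑ x ∈ tail, d x - d m :=
    Finset.sum_erase_eq_sub hm
  have hm' : lam r ≤ d m := by
    simp only [htail, Finset.mem_filter, Finset.mem_univ, true_and] at hm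
    exact hle m hm.2
  have hrest : 0 ≤ ∑ x ∈ tail.erase m, d x := Finset.sum_nonneg fun x _ => hd x
  have hkτ' : (0 : ℝ) < (τ : ℝ) - k := sub_pos.2 (by exact_mod_cast hkτ)
  rw [← Finset.sum_div, hsum]
  set s := ∑ x ∈ tail, d x with hs
  have hs1 : 1 ≤ s / lam r := by
    rw [le_div_iff₀ hlr]
    linarith
  have hden : 0 < (τ : ℝ) - k - 1 + s / lam r := by linarith
  rw [← mul_div_assoc, div_le_iff₀ hden]
  have hcmp : lam r * (((τ : ℝ) - k) * N) ≤ (s - lam r) * P := by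
    calc lam r * (((τ : ℝ) - k) * N) ≤ d i * (((τ : ℝ) - k) * N) :=
          mul_le_mul_of_nonneg_right (hle i hir) (mul_nonneg hkτ'.le hN)
      _ ≤ (s - d m) * P := by rw [← herase]; exact key
      _ ≤ (s - lam r) * P := mul_le_mul_of_nonneg_right (by linarith) hP
  have hdiv : ((τ : ℝ) - k) * N ≤ (s / lam r - 1) * P := by
    have h : (s / lam r - 1) * P = (s - lam r) * P / lam r := by
      field_simp
    rw [h, le_div_iff₀ hlr]
    linarith
  linarith

/-- block coordinate descent analogue of the expected-projection
bound: let `A` be a real symmetric psd `n × n` matrix of rank `r` with eigenvalues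
`λ₁ ≥ … ≥ λ_n ≥ 0` (1-based, via an orthogonal eigendecomposition; `λ_i > 0` exactly
when `i ≤ r`), and `1 ≤ k < τ < r`. With
`N := Σ_{|S| = τ} A_{:,S} · adj(A_{S,S}) · A_{S,:}` and `D := Σ_{|S| = τ} det(A_{S,S})`,
we have `D > 0` and, for every `w ∈ ℝⁿ`,
`wᵀ N w ≥ D · (τ−k)/(τ−k−1 + Σ_{j=k+1}^r λ_j/λ_r) · wᵀAw`. -/
theorem stmt16 {n r : ℕ} (A : Matrix (Fin n) (Fin n) ℝ) (hr : A.rank = r)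
    (lam : ℕ → ℝ) (Q : Matrix (Fin n) (Fin n) ℝ) (hQ : Qᵀ * Q = 1)
    (hA : A = Q * Matrix.diagonal (fun i : Fin n => lam ((i : ℕ) + 1)) * Qᵀ)
    (hmono : ∀ i j : ℕ, 1 ≤ i → i ≤ j → j ≤ n → lam j ≤ lam i)
    (hnonneg : ∀ i : ℕ, 1 ≤ i → i ≤ n → 0 ≤ lam i)
    (hpos : ∀ i : ℕ, 1 ≤ i → i ≤ n → (0 < lam i ↔ i ≤ r))
    (k τ : ℕ) (hk : 1 ≤ k) (hkτ : k < τ) (hτr : τ < r) :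
    0 < (∑ S ∈ Finset.powersetCard τ (Finset.univ : Finset (Fin n)),
          principalMinor A S) ∧
      ∀ w : Fin n → ℝ,
        (∑ S ∈ Finset.powersetCard τ (Finset.univ : Finset (Fin n)),
              principalMinor A S) *
            (((τ : ℝ) - k) /
              (((τ : ℝ) - k) - 1 + ∑ j ∈ Finset.Icc (k + 1) r, lam j / lam r)) *
            (w ⬝ᵥ (A *ᵥ w))
          ≤ w ⬝ᵥ ((∑ S ∈ Finset.powersetCard τ (Finset.univ : Finset (Fin n)),
              colSub A S * principalAdj A S * rowSub A S) *ᵥ w) := by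
  have hrn : r ≤ n := by
    rw [← hr]
    simpa using A.rank_le_width
  set d : Fin n → ℝ := fun i => lam ((i : ℕ) + 1) with hdef
  have hd : ∀ x, 0 ≤ d x := fun x => hnonneg _ (by omega) (by omega)
  have hD : ∑ S ∈ Finset.powersetCard τ (Finset.univ : Finset (Fin n)), principalMinor A S
      = ∑ S ∈ Finset.powersetCard τ (Finset.univ : Finset (Fin n)), ∏ x ∈ S, d x := by
    rw [hA, sum_principalMinor_conj Q _ hQ]
    exact Finset.sum_congr rfl fun S _ => principalMinor_diagonal d S
  refine ⟨?_, fun w => ?_⟩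
  · rw [hD]
    refine Finset.sum_pos' (fun S _ => Finset.prod_nonneg fun x _ => hd x)
      ⟨Finset.univ.filter fun x : Fin n => (x : ℕ) < τ, ?_, ?_⟩
    · rw [Finset.mem_powersetCard_univ, Fin.card_filter_val_lt]
      omega
    · refine Finset.prod_pos fun x hx => ?_
      simp only [Finset.mem_filter, Finset.mem_univ, true_and] at hx
      exact (hpos _ (by omega) (by omega)).2 (by omega)
  set z : Fin n → ℝ := Qᵀ *ᵥ w with hz
  have hzw : w ᵥ* Q = z := by rw [hz, mulVec_transpose]
  have hquad : w ⬝ᵥ (A *ᵥ w) = ∑ i, d i * z i ^ 2 := by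
    rw [hA, ← mulVec_mulVec, ← mulVec_mulVec, dotProduct_mulVec, hzw, ← hz]
    simp only [dotProduct, mulVec_diagonal]
    exact Finset.sum_congr rfl fun i _ => by ring
  have hupd : A + vecMulVec (A *ᵥ w) (w ᵥ* A)
      = Q * (diagonal d + vecMulVec (diagonal d *ᵥ z) (z ᵥ* diagonal d)) * Qᵀ := by
    rw [Matrix.mul_add, Matrix.add_mul, ← hA, mul_vecMulVec, vecMulVec_mul]
    congr 2
    · rw [hA, ← mulVec_mulVec, ← mulVec_mulVec]
    · rw [hA, ← vecMul_vecMul, ← vecMul_vecMul, hzw]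
  have hN : w ⬝ᵥ ((∑ S ∈ Finset.powersetCard τ (Finset.univ : Finset (Fin n)),
        colSub A S * principalAdj A S * rowSub A S) *ᵥ w)
      = ∑ i, d i * z i ^ 2 *
        ∑ S ∈ Finset.powersetCard τ (Finset.univ : Finset (Fin n)) with i ∈ S,
          ∏ x ∈ S, d x := by
    rw [sum_mulVec, dotProduct_sum]
    simp_rw [dotProduct_principalAdj_mulVec]
    rw [Finset.sum_sub_distrib, hupd, sum_principalMinor_conj Q _ hQ]
    conv_lhs => rw [hA]
    rw [sum_principalMinor_conj Q _ hQ, ← Finset.sum_sub_distrib]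
    simp_rw [← dotProduct_principalAdj_mulVec, dotProduct_principalAdj_diagonal_mulVec,
      Finset.mul_sum, Finset.sum_filter]
    rw [Finset.sum_comm]
    refine Finset.sum_congr rfl fun S _ => ?_
    rw [← Finset.sum_filter, Finset.filter_mem_eq_inter, Finset.univ_inter]
  rw [hN, hquad, hD, Finset.mul_sum]
  refine Finset.sum_le_sum fun i _ => ?_
  by_cases hir : (i : ℕ) < r
  · rw [mul_comm]
    exact mul_le_mul_of_nonneg_left
      (sum_prod_mem_lower_bound lam hrn hmono hnonneg hpos k τ hkτ hτr i hir)
      (mul_nonneg (hd i) (sq_nonneg _))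
  · have h0 : d i = 0 := by
      refine le_antisymm (not_lt.1 fun h => hir ?_) (hd i)
      have := (hpos ((i : ℕ) + 1) (by omega) (by omega)).1 h
      omega
    simp [h0]
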